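/- arXiv:1205.4196 — 2 statements merged into one kernel-verified Lean document; each statement's English description precedes it below -/
import Mathlib

section
/- Let J ⊆ I be a nonempty closed connected subset, and let h : S¹ × I → S¹ × I be a continuous level-preserving map such that h(z, τ) = (z, τ) for every z ∈ S¹ and every τ ∈ J. Then there exists a unique continuous function Δ : S¹ × I → ℝ such that Δ(z, τ) = 0 for all z ∈ S¹ and τ ∈ J, and h(z, τ) = (e^{2πi·Δ(z,τ)} · z, τ) for all (z, τ) ∈ S¹ × I. -/
open unitInterval

/-- The point `(1 - t) a + t b` of the unit interval. -/
noncomputable def unitInterval.segment (a t b : unitInterval) : unitInterval :=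
  ⟨(1 - (t : ℝ)) * a + t * b,
    convex_Icc (0 : ℝ) 1 a.2 b.2 (sub_nonneg.2 t.2.2) t.2.1 (by ring)⟩

namespace unitInterval

theorem continuous_segment (a : unitInterval) :
    Continuous fun q : unitInterval × unitInterval => segment a q.1 q.2 := by
  unfold segment
  fun_prop

theorem segment_zero (a b : unitInterval) : segment a 0 b = a := by
  ext; simp [segment]

theorem segment_one (a b : unitInterval) : segment a 1 b = b := by
  ext; simp [segment]

theorem segment_mem_uIcc (a t b : unitInterval) : segment a t b ∈ Set.uIcc a b := by
  have h0 := t.2.1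
  have h1 := t.2.2
  rw [Set.mem_uIcc]
  rcases le_total a b with hab | hab
  · left
    have hab' : (a : ℝ) ≤ b := hab
    constructor <;> rw [← Subtype.coe_le_coe] <;> simp only [segment] <;> nlinarith
  · right
    have hab' : (b : ℝ) ≤ a := hab
    constructor <;> rw [← Subtype.coe_le_coe] <;> simp only [segment] <;> nlinarith

end unitInterval

/-- A circle-valued map on `X × I` that is `1` over a nonempty connected `J ⊆ I` has a
continuous argument that vanishes over `J`. -/
theorem Circle.exists_continuous_arg_of_eq_one {X : Type*} [TopologicalSpace X]
    {J : Set unitInterval} (hJne : J.Nonempty) (hJconn : IsPreconnected J)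
    {g : X × unitInterval → Circle} (hg : Continuous g)
    (hgJ : ∀ x, ∀ τ ∈ J, g (x, τ) = 1) :
    ∃ θ : X × unitInterval → ℝ, Continuous θ ∧ (∀ x, ∀ τ ∈ J, θ (x, τ) = 0) ∧
      ∀ p, Circle.exp (θ p) = g p := by
  obtain ⟨a, ha⟩ := hJne
  have hseg (t : unitInterval) {b : unitInterval} (hb : b ∈ J) : segment a t b ∈ J :=
    hJconn.ordConnected.uIcc_subset ha hb (segment_mem_uIcc a t b)
  let H : C(unitInterval × (X × unitInterval), Circle) :=
    ⟨fun q => g (q.2.1, segment a q.1 q.2.2), hg.comp <| .prodMk (by fun_prop) <|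
      (continuous_segment a).comp (f := fun q : unitInterval × (X × unitInterval) =>
        (q.1, q.2.2)) (by fun_prop)⟩
  have H_zero (p : X × unitInterval) : H (0, p) = Circle.exp ((0 : C(X × unitInterval, ℝ)) p) := by
    simp [H, segment_zero, hgJ _ _ ha]
  let L := Circle.isCoveringMap_exp.liftHomotopy H 0 H_zero
  have L_lifts (t : unitInterval) (p : X × unitInterval) : Circle.exp (L (t, p)) = H (t, p) :=
    congr_fun (Circle.isCoveringMap_exp.liftHomotopy_lifts H 0 H_zero) (t, p)
  refine ⟨fun p => L (1, p), by fun_prop, fun x τ hτ => ?_, fun p => ?_⟩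
  · have hconst := Circle.isCoveringMap_exp.const_of_comp (g := fun t => L (t, (x, τ)))
      (by fun_prop) (fun t t' => by
        simp only [L_lifts]
        simp [H, hgJ _ _ (hseg _ hτ)]) 1 0
    exact hconst.trans (Circle.isCoveringMap_exp.liftHomotopy_zero H 0 H_zero (x, τ))
  · rw [L_lifts]
    simp [H, segment_one]

/-- For a continuous level-preserving map `h` of `S¹ × I` fixed on `S¹ × J`,
where `J ⊆ I` is nonempty closed and connected, there is a unique continuous
`Δ : S¹ × I → ℝ` vanishing on `S¹ × J` with `h (z, τ) = (exp(2πi Δ(z,τ)) z, τ)`. -/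
theorem stmt0 (J : Set unitInterval) (hJne : J.Nonempty) (hJcl : IsClosed J)
    (hJconn : IsPreconnected J)
    (h : Circle × unitInterval → Circle × unitInterval) (hcont : Continuous h)
    (hlevel : ∀ p : Circle × unitInterval, (h p).2 = p.2)
    (hfix : ∀ (z : Circle) (τ : unitInterval), τ ∈ J → h (z, τ) = (z, τ)) :
    ∃! Δ : Circle × unitInterval → ℝ,
      Continuous Δ ∧
      (∀ (z : Circle) (τ : unitInterval), τ ∈ J → Δ (z, τ) = 0) ∧
      (∀ p : Circle × unitInterval,
        h p = (Circle.exp (2 * Real.pi * Δ p) * p.1, p.2)) := by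
  have hpi : 2 * Real.pi ≠ 0 := by positivity
  refine existsUnique_of_exists_of_unique ?_ ?_
  · obtain ⟨θ, hθ, hθJ, hexp⟩ := Circle.exists_continuous_arg_of_eq_one hJne hJconn
      (g := fun p => (h p).1 * p.1⁻¹) (by fun_prop)
      (fun z τ hτ => by simp [hfix z τ hτ])
    refine ⟨fun p => θ p / (2 * Real.pi), by fun_prop, fun z τ hτ => ?_, fun p => ?_⟩
    · simp [hθJ z τ hτ]
    · refine Prod.ext ?_ (hlevel p)
      simp only [mul_div_cancel₀ _ hpi, hexp, inv_mul_cancel_right]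
  · rintro Δ Δ' ⟨hΔ, hΔJ, hΔh⟩ ⟨hΔ', hΔJ', hΔh'⟩
    obtain ⟨a, ha⟩ := hJne
    ext ⟨z, τ⟩
    have heq : (fun s => 2 * Real.pi * Δ (z, s)) = fun s => 2 * Real.pi * Δ' (z, s) :=
      Circle.isCoveringMap_exp.eq_of_comp_eq (by fun_prop) (by fun_prop)
        (funext fun s => mul_right_cancel
          (congr_arg Prod.fst ((hΔh (z, s)).symm.trans (hΔh' (z, s))))) a
        (by simp [hΔJ z a ha, hΔJ' z a ha])
    exact mul_left_cancel₀ hpi (congr_fun heq τ)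
end

section
/- Let g ∈ ℝ[x, y] be a homogeneous polynomial in two real variables of degree n ≥ 1 which is squarefree (has no repeated irreducible factor). Then g, regarded as a smooth function ℝ² → ℝ, has no critical points on ℝ² ∖ {(0,0)}: for every point p ∈ ℝ² with p ≠ (0,0), at least one of the partial derivatives ∂g/∂x and ∂g/∂y does not vanish at p. -/
open MvPolynomial

theorem MvPolynomial.IsHomogeneous.aeval_mul {σ R A : Type*} [CommSemiring R] [CommSemiring A]
    [Algebra R A] {f : MvPolynomial σ R} {n : ℕ} (hf : f.IsHomogeneous n) (c : A) (v : σ → A) :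
    MvPolynomial.aeval (fun j ↦ c * v j) f = c ^ n * MvPolynomial.aeval v f := by
  simp only [aeval_def, eval₂_eq, Finset.mul_sum]
  refine Finset.sum_congr rfl fun d hd ↦ ?_
  rw [hf.degree_eq_sum_deg_support hd]
  simp only [mul_pow, Finset.prod_mul_distrib, Finset.prod_pow_eq_pow_sum]
  ring

/-- A homogeneous polynomial vanishing at `p`, where `p i ≠ 0`, lies in every ideal containing
the linear forms `p i X_j - p j X_i`. -/
theorem MvPolynomial.IsHomogeneous.mem_of_eval_eq_zero {σ K : Type*} [Field K]
    {f : MvPolynomial σ K} {n : ℕ} (hf : f.IsHomogeneous n) {p : σ → K} {i : σ} (hi : p i ≠ 0)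
    (hp : eval p f = 0) (I : Ideal (MvPolynomial σ K))
    (hI : ∀ j, C (p i) * X j - C (p j) * X i ∈ I) : f ∈ I := by
  let π := Ideal.Quotient.mkₐ K I
  have hX (j : σ) : π (C (p i)) * π (X j) = π (X i) * π (C (p j)) := by
    rw [← map_mul, ← map_mul, mul_comm (X i)]
    exact Ideal.Quotient.eq.2 (hI j)
  have h₁ := hf.aeval_mul (π (C (p i))) (fun j ↦ π (X j))
  have h₂ := hf.aeval_mul (π (X i)) (fun j ↦ π (C (p j)))
  have hπ : MvPolynomial.aeval (fun j ↦ π (X j)) f = π f := by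
    rw [← comp_aeval_apply, aeval_X_left_apply]
  have hC : MvPolynomial.aeval (fun j ↦ π (C (p j))) f = 0 := by
    have h := aeval_algebraMap_apply (MvPolynomial σ K ⧸ I) p f
    rw [aeval_eq_eval, hp, map_zero] at h
    exact h
  have h : π (C (p i ^ n) * f) = 0 := by
    simp only [hX] at h₁
    rw [map_mul, C_pow, map_pow, ← hπ, ← h₁, h₂, hC, mul_zero]
  have hmem : C (p i ^ n) * f ∈ I := Ideal.Quotient.eq_zero_iff_mem.1 h
  have hu : IsUnit (C (p i ^ n) : MvPolynomial σ K) := (pow_ne_zero n hi).isUnit.map C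
  exact (Ideal.unit_mul_mem_iff_mem I hu).1 hmem

/-- A homogeneous polynomial in two variables vanishing at `p ≠ 0` is divisible by the linear
form defining the line through `p`. -/
theorem MvPolynomial.IsHomogeneous.linear_dvd_of_eval_eq_zero {K : Type*} [Field K]
    {f : MvPolynomial (Fin 2) K} {n : ℕ} (hf : f.IsHomogeneous n) {p : Fin 2 → K} (h0 : p ≠ 0)
    (hp : eval p f = 0) : C (p 1) * X 0 - C (p 0) * X 1 ∣ f := by
  obtain ⟨i, hi⟩ := Function.ne_iff.1 h0
  rw [← Ideal.mem_span_singleton]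
  refine hf.mem_of_eval_eq_zero hi hp _ fun j ↦ Ideal.mem_span_singleton.2 ?_
  fin_cases i <;> fin_cases j
  · simp
  · exact ⟨-1, by simp⟩
  · simp
  · simp

/-- A squarefree homogeneous real polynomial in two variables of degree `n ≥ 1`
has no critical points away from the origin. -/
theorem stmt11 (g : MvPolynomial (Fin 2) ℝ) (n : ℕ) (hn : 1 ≤ n)
    (hhom : g.IsHomogeneous n) (hsf : Squarefree g) :
    ∀ p : Fin 2 → ℝ, p ≠ 0 →
      eval p (pderiv 0 g) ≠ 0 ∨ eval p (pderiv 1 g) ≠ 0 := by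
  intro p hp
  by_contra! hcrit
  have hd₀ := (hhom.pderiv (i := 0)).linear_dvd_of_eval_eq_zero hp hcrit.1
  have hd₁ := (hhom.pderiv (i := 1)).linear_dvd_of_eval_eq_zero hp hcrit.2
  set L : MvPolynomial (Fin 2) ℝ := C (p 1) * X 0 - C (p 0) * X 1 with hL
  have unit_C {c : ℝ} (hc : c ≠ 0) : IsUnit (C c : MvPolynomial (Fin 2) ℝ) := hc.isUnit.map C
  have hLg : L ∣ g := by
    have euler := hhom.sum_X_mul_pderiv
    rw [Fin.sum_univ_two, nsmul_eq_mul, ← map_natCast C] at euler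
    have hn0 : (n : ℝ) ≠ 0 := by positivity
    rw [← (unit_C hn0).dvd_mul_left, ← euler]
    exact dvd_add (hd₀.mul_left _) (hd₁.mul_left _)
  obtain ⟨h, rfl⟩ := hLg
  have hL₀ : pderiv 0 L = C (p 1) := by simp [hL, pderiv_X]
  have hL₁ : pderiv 1 L = -C (p 0) := by simp [hL, pderiv_X]
  rw [pderiv_mul, hL₀, dvd_add_left (dvd_mul_right _ _)] at hd₀
  rw [pderiv_mul, hL₁, dvd_add_left (dvd_mul_right _ _), neg_mul, dvd_neg] at hd₁
  have hLh : L ∣ h := by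
    obtain ⟨i, hi⟩ := Function.ne_iff.1 hp
    fin_cases i
    · exact (unit_C hi).dvd_mul_left.1 hd₁
    · exact (unit_C hi).dvd_mul_left.1 hd₀
  have hu := (hsf L (mul_dvd_mul_left L hLh)).map (eval p)
  simp [hL, mul_comm] at hu
end
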